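/- Fix 0 < α < 1 and a bounded function f on [0,1]. Define the low-mode fluctuation fields r̃^{(1)}(t) = Σ_{1 ≤ k ≤ N^{1−α}} ( ω_k^{−1}⟨∇₊ψ^k, r̃(0)⟩ cos(ω_k t) + ⟨ψ^k, p̃(0)⟩ sin(ω_k t) ) ω_k^{−1} ∇₊ψ^k and p̃^{(1)}(t) = Σ_{0 ≤ k ≤ N^{1−α}} ( ⟨ψ^k, p̃(0)⟩ cos(ω_k t) − ω_k^{−1}⟨∇₊ψ^k, r̃(0)⟩ sin(ω_k t) ) Mψ^k (the term in ω_k^{−1} being absent for k = 0), where r̃(0) = r(0) − ⟨r(0)⟩ and p̃(0) = p(0) − ⟨p(0)⟩ are the centered initial data under the local Gibbs state. Then there exists a constant C, depending only on sup|f| and β₋ := min_{[0,1]} β, such that for every N ≥ 2, every mass configuration with m₋ ≤ m_x ≤ m₊, and every t ∈ ℝ: |ℱ^{(1)}_N(t)| := |(1/N) Σ_{x=1}^N f(x/N) ( ⟨(p̃^{(1)}_x)²(t)⟩/(2m_x) + ⟨(r̃^{(1)}_x)²(t)⟩/2 )| ≤ C N^{−α}. In particular ℱ^{(1)}_N(t)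 → 0 as N → ∞. -/

import Mathlib

open Finset MeasureTheory ProbabilityTheory

/-- The local Gibbs state: the Gaussian product measure on `(r_1,…,r_{N-1},p_1,…,p_N)`
(the `Fin (N-1)`- resp. `Fin N`-coordinate `x` standing for the component `x+1`), where
`r_x` has mean `𝗋(x/N)` and variance `1/β(x/N)`, and `p_x` has mean `m_x 𝗉(x/N)/m̄` and
variance `m_x/β(x/N)`. -/
noncomputable def gibbsMeasure (N : ℕ) (m : ℕ → ℝ) (β rr pp : ℝ → ℝ) (mbar : ℝ) :
    Measure ((Fin (N - 1) → ℝ) × (Fin N → ℝ)) :=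
  (Measure.pi fun x : Fin (N - 1) =>
      gaussianReal (rr (((x : ℕ) + 1 : ℝ) / N))
        (Real.toNNReal (1 / β (((x : ℕ) + 1 : ℝ) / N)))).prod
    (Measure.pi fun x : Fin N =>
      gaussianReal (m ((x : ℕ) + 1) * pp (((x : ℕ) + 1 : ℝ) / N) / mbar)
        (Real.toNNReal (m ((x : ℕ) + 1) / β (((x : ℕ) + 1 : ℝ) / N))))

/-- Eigenmodes of the operator `M⁻¹(−Δ)` with free boundary conditions
(`ψ_0 = ψ_1`, `ψ_{N+1} = ψ_N`), normalized by `⟨ψ^j, Mψ^k⟩ = δ_{jk}`, with `ω_0 = 0` and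
`ω_k > 0` for `1 ≤ k ≤ N−1`. -/
def IsEigenSystem (N : ℕ) (m : ℕ → ℝ) (ψ : ℕ → ℕ → ℝ) (W : ℕ → ℝ) : Prop :=
  (∀ k ≤ N - 1, ψ k 0 = ψ k 1 ∧ ψ k (N + 1) = ψ k N) ∧
  (∀ k ≤ N - 1, ∀ x : ℕ, 1 ≤ x → x ≤ N →
    -(ψ k (x + 1) - 2 * ψ k x + ψ k (x - 1)) = (W k) ^ 2 * (m x * ψ k x)) ∧
  (∀ j ≤ N - 1, ∀ k ≤ N - 1,
    (∑ x ∈ Finset.Icc 1 N, m x * ψ j x * ψ k x) = if j = k then 1 else 0) ∧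
  W 0 = 0 ∧ (∀ k : ℕ, 1 ≤ k → k ≤ N - 1 → 0 < W k)

/-- The mode coordinate `⟨ψ^k, p − ⟨p⟩⟩ = Σ_{x=1}^N ψ^k_x (p_x − ⟨p_x⟩)` of the centered
momenta under the measure `ρ`. -/
noncomputable def pCoord (N : ℕ) (ρ : Measure ((Fin (N - 1) → ℝ) × (Fin N → ℝ)))
    (ψk : ℕ → ℝ) (z : (Fin (N - 1) → ℝ) × (Fin N → ℝ)) : ℝ :=
  ∑ y : Fin N, ψk ((y : ℕ) + 1) * (z.2 y - ∫ z', z'.2 y ∂ρ)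

/-- The mode coordinate `⟨∇₊ψ^k, r − ⟨r⟩⟩ = Σ_{x=1}^{N−1} (ψ^k_{x+1} − ψ^k_x)(r_x − ⟨r_x⟩)`
of the centered stretches under the measure `ρ`. -/
noncomputable def rCoord (N : ℕ) (ρ : Measure ((Fin (N - 1) → ℝ) × (Fin N → ℝ)))
    (ψk : ℕ → ℝ) (z : (Fin (N - 1) → ℝ) × (Fin N → ℝ)) : ℝ :=
  ∑ y : Fin (N - 1), (ψk ((y : ℕ) + 2) - ψk ((y : ℕ) + 1)) * (z.1 y - ∫ z', z'.1 y ∂ρ)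

lemma aux_gauss {ι : Type*} [Fintype ι] (a : ι → ℝ) (v : ι → NNReal) (c : ι → ℝ) :
    MemLp (fun x : ι → ℝ => ∑ i, c i * (x i - a i)) 2
      (Measure.pi fun i => gaussianReal (a i) (v i)) ∧
    ∫ x : ι → ℝ, (∑ i, c i * (x i - a i)) ^ 2 ∂(Measure.pi fun i => gaussianReal (a i) (v i))
      = ∑ i, c i ^ 2 * v i := by
  have h1 : ∀ i, MemLp (fun y : ℝ => c i * (y - a i)) 2 (gaussianReal (a i) (v i)) := fun i =>
    ((IsGaussian.memLp_two_id (μ := gaussianReal (a i) (v i))).sub (memLp_const (a i))).const_mul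
      (c i)
  have h2 : ∀ i, MemLp (fun x : ι → ℝ => c i * (x i - a i)) 2
      (Measure.pi fun i => gaussianReal (a i) (v i)) := fun i =>
    (h1 i).comp_measurePreserving
      (measurePreserving_eval (μ := fun i => gaussianReal (a i) (v i)) i)
  have h3 : MemLp (fun x : ι → ℝ => ∑ i, c i * (x i - a i)) 2
      (Measure.pi fun i => gaussianReal (a i) (v i)) := memLp_finsetSum _ fun i _ => h2 i
  refine ⟨h3, ?_⟩
  have hmean : ∀ i, ∫ x : ι → ℝ, c i * (x i - a i)
      ∂(Measure.pi fun i => gaussianReal (a i) (v i)) = 0 := by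
    intro i
    have := integral_comp_eval (μ := fun i => gaussianReal (a i) (v i)) (i := i)
      (f := fun y : ℝ => c i * (y - a i)) (h1 i).1
    rw [this, integral_const_mul, integral_sub]
    · simp
    · exact (IsGaussian.memLp_two_id (μ := gaussianReal (a i) (v i))).integrable (by norm_num)
    · simp
  have h4 : ∫ x : ι → ℝ, ∑ i, c i * (x i - a i)
      ∂(Measure.pi fun i => gaussianReal (a i) (v i)) = 0 := by
    rw [integral_finsetSum _ fun i _ => (h2 i).integrable (by norm_num)]
    simp [hmean]
  rw [← variance_of_integral_eq_zero h3.1.aemeasurable h4]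
  have h5 := variance_sum_pi (μ := fun i => gaussianReal (a i) (v i)) h1
  have h6 : (∑ i, fun ω : ι → ℝ => c i * (ω i - a i))
      = fun x : ι → ℝ => ∑ i, c i * (x i - a i) := by
    ext x; simp
  rw [h6] at h5
  rw [h5]
  refine Finset.sum_congr rfl fun i _ => ?_
  rw [variance_const_mul]
  have := variance_sub_const (X := fun y : ℝ => y) (μ := gaussianReal (a i) (v i))
    aestronglyMeasurable_id (a i)
  rw [this, variance_fun_id_gaussianReal]

lemma aux_parseval {Ω : Type*} [MeasurableSpace Ω] (ρ : Measure Ω) (S X : Finset ℕ)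
    (a : ℕ → Ω → ℝ) (ha : ∀ k ∈ S, MemLp (a k) 2 ρ) (φ : ℕ → ℕ → ℝ) (w : ℕ → ℝ)
    (ho : ∀ j ∈ S, ∀ k ∈ S, ∑ x ∈ X, w x * (φ j x * φ k x) = if j = k then 1 else 0) :
    ∑ x ∈ X, w x * ∫ z, (∑ k ∈ S, a k z * φ k x) ^ 2 ∂ρ = ∑ k ∈ S, ∫ z, a k z ^ 2 ∂ρ := by
  have hi : ∀ x, Integrable (fun z => (∑ k ∈ S, a k z * φ k x) ^ 2) ρ := fun x =>
    (memLp_finsetSum S (f := fun k z => a k z * φ k x)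
      fun k hk => (ha k hk).mul_const (φ k x)).integrable_sq
  simp_rw [← integral_const_mul]
  rw [← integral_finsetSum _ fun x _ => (hi x).const_mul _,
    ← integral_finsetSum _ fun k hk => (ha k hk).integrable_sq]
  congr 1
  ext z
  calc ∑ x ∈ X, w x * (∑ k ∈ S, a k z * φ k x) ^ 2
      = ∑ x ∈ X, ∑ j ∈ S, ∑ k ∈ S, a j z * a k z * (w x * (φ j x * φ k x)) := by
        refine Finset.sum_congr rfl fun x _ => ?_
        rw [sq, Finset.sum_mul_sum, Finset.mul_sum]
        refine Finset.sum_congr rfl fun j _ => ?_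
        rw [Finset.mul_sum]
        exact Finset.sum_congr rfl fun k _ => by ring
    _ = ∑ j ∈ S, ∑ k ∈ S, a j z * a k z * ∑ x ∈ X, w x * (φ j x * φ k x) := by
        rw [Finset.sum_comm]
        refine Finset.sum_congr rfl fun j _ => ?_
        rw [Finset.sum_comm]
        exact Finset.sum_congr rfl fun k _ => by rw [Finset.mul_sum]
    _ = ∑ j ∈ S, ∑ k ∈ S, a j z * a k z * (if j = k then 1 else 0) :=
        Finset.sum_congr rfl fun j hj => Finset.sum_congr rfl fun k hk => by rw [ho j hj k hk]
    _ = ∑ k ∈ S, a k z ^ 2 := by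
        refine Finset.sum_congr rfl fun j hj => ?_
        simp [hj, sq]

lemma aux_parts (u v : ℕ → ℝ) (n : ℕ) :
    ∑ x ∈ Finset.Icc 1 n, (u (x + 1) - u x) * (v (x + 1) - v x)
      = ∑ x ∈ Finset.Icc 1 n, u x * -(v (x + 1) - 2 * v x + v (x - 1))
        + u (n + 1) * (v (n + 1) - v n) - u 1 * (v 1 - v 0) := by
  induction n with
  | zero => simp
  | succ n ih =>
    rw [Finset.sum_Icc_succ_top (by omega), Finset.sum_Icc_succ_top (by omega), ih]
    simp only [Nat.add_sub_cancel]
    ring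

lemma aux_grad {N : ℕ} {m : ℕ → ℝ} {ψ : ℕ → ℕ → ℝ} {W : ℕ → ℝ} (h : IsEigenSystem N m ψ W)
    (j k : ℕ) (hj : j ≤ N - 1) (hk : k ≤ N - 1) :
    ∑ x ∈ Finset.Icc 1 N, (ψ j (x + 1) - ψ j x) * (ψ k (x + 1) - ψ k x)
      = if j = k then W k ^ 2 else 0 := by
  obtain ⟨hb, he, ho, -, -⟩ := h
  rw [aux_parts, (hb k hk).1, (hb k hk).2]
  have : ∑ x ∈ Finset.Icc 1 N, ψ j x * -(ψ k (x + 1) - 2 * ψ k x + ψ k (x - 1))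
      = W k ^ 2 * ∑ x ∈ Finset.Icc 1 N, m x * ψ j x * ψ k x := by
    rw [Finset.mul_sum]
    refine Finset.sum_congr rfl fun x hx => ?_
    rw [Finset.mem_Icc] at hx
    rw [he k hk x hx.1 hx.2]
    ring
  rw [this, ho j hj k hk]
  simp

lemma aux_fin (n : ℕ) (g : ℕ → ℝ) :
    ∑ y : Fin n, g ((y : ℕ) + 1) = ∑ x ∈ Finset.Icc 1 n, g x := by
  rw [Fin.sum_univ_eq_sum_range (fun i => g (i + 1)) n]
  induction n with
  | zero => simp
  | succ n ih => rw [Finset.sum_range_succ, ih, Finset.sum_Icc_succ_top (by omega)]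

lemma aux_unit {N n : ℕ} (hn : n ≤ N) (y : Fin n) :
    (((y : ℕ) + 1 : ℝ) / N) ∈ Set.Icc (0 : ℝ) 1 := by
  have hy : ((y : ℕ) : ℝ) + 1 ≤ N := by exact_mod_cast (show (y : ℕ) + 1 ≤ N by omega)
  have : (0 : ℝ) < N := by
    have : (0 : ℝ) ≤ ((y : ℕ) : ℝ) := by positivity
    linarith
  exact ⟨by positivity, by rw [div_le_one this]; exact hy⟩

lemma aux_p (N : ℕ) (m : ℕ → ℝ) (hm : ∀ x, 0 < m x) (β rr pp : ℝ → ℝ) (mbar b : ℝ)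
    (hb : 0 < b) (hβ : ∀ y ∈ Set.Icc (0:ℝ) 1, b ≤ β y) (u : ℕ → ℝ) :
    MemLp (pCoord N (gibbsMeasure N m β rr pp mbar) u) 2 (gibbsMeasure N m β rr pp mbar) ∧
    ∫ z, pCoord N (gibbsMeasure N m β rr pp mbar) u z ^ 2 ∂(gibbsMeasure N m β rr pp mbar)
      ≤ (∑ x ∈ Finset.Icc 1 N, m x * u x * u x) / b := by
  set a : Fin N → ℝ := fun x => m ((x : ℕ) + 1) * pp (((x : ℕ) + 1 : ℝ) / N) / mbar with ha
  set v : Fin N → NNReal := fun x =>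
    Real.toNNReal (m ((x : ℕ) + 1) / β (((x : ℕ) + 1 : ℝ) / N)) with hv
  have hmp : MeasurePreserving Prod.snd (gibbsMeasure N m β rr pp mbar)
      (Measure.pi fun i => gaussianReal (a i) (v i)) := measurePreserving_snd
  have hmean : ∀ y, ∫ z', z'.2 y ∂(gibbsMeasure N m β rr pp mbar) = a y := by
    intro y
    have h := ((measurePreserving_eval (μ := fun i => gaussianReal (a i) (v i)) y).comp hmp)
    have h2 := integral_map (μ := gibbsMeasure N m β rr pp mbar) h.measurable.aemeasurable (f := fun x : ℝ => x)
      aestronglyMeasurable_id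
    rw [h.map_eq, integral_id_gaussianReal] at h2
    exact h2.symm
  have hfun : pCoord N (gibbsMeasure N m β rr pp mbar) u
      = (fun x : Fin N → ℝ => ∑ i : Fin N, u ((i : ℕ) + 1) * (x i - a i)) ∘ Prod.snd := by
    ext z
    simp only [pCoord, hmean, Function.comp]
  obtain ⟨h1, h2⟩ := aux_gauss a v (fun i => u ((i : ℕ) + 1))
  rw [hfun]
  refine ⟨h1.comp_measurePreserving hmp, ?_⟩
  have h3 := integral_map (μ := gibbsMeasure N m β rr pp mbar) hmp.measurable.aemeasurable
    (f := fun x : Fin N → ℝ => (∑ i : Fin N, u ((i : ℕ) + 1) * (x i - a i)) ^ 2)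
    (by rw [hmp.map_eq]; exact h1.integrable_sq.1)
  rw [hmp.map_eq, h2] at h3
  refine (le_of_eq h3.symm).trans ?_
  rw [← aux_fin N (fun x => m x * u x * u x), Finset.sum_div]
  refine Finset.sum_le_sum fun y _ => ?_
  have hβy := hβ _ (aux_unit le_rfl y)
  have hmy := hm ((y : ℕ) + 1)
  have hv' : (v y : ℝ) ≤ m ((y : ℕ) + 1) / b := by
    rw [hv, Real.coe_toNNReal _ (div_nonneg hmy.le (hb.le.trans hβy))]
    exact div_le_div_of_nonneg_left hmy.le hb hβy
  calc u ((y : ℕ) + 1) ^ 2 * (v y : ℝ) ≤ u ((y : ℕ) + 1) ^ 2 * (m ((y : ℕ) + 1) / b) := by gcongr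
    _ = _ := by ring

lemma aux_r (N : ℕ) (m : ℕ → ℝ) (β rr pp : ℝ → ℝ) (mbar b : ℝ)
    (hb : 0 < b) (hβ : ∀ y ∈ Set.Icc (0:ℝ) 1, b ≤ β y) (u : ℕ → ℝ) :
    MemLp (rCoord N (gibbsMeasure N m β rr pp mbar) u) 2 (gibbsMeasure N m β rr pp mbar) ∧
    ∫ z, rCoord N (gibbsMeasure N m β rr pp mbar) u z ^ 2 ∂(gibbsMeasure N m β rr pp mbar)
      ≤ (∑ x ∈ Finset.Icc 1 N, (u (x + 1) - u x) * (u (x + 1) - u x)) / b := by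
  set a : Fin (N - 1) → ℝ := fun x => rr (((x : ℕ) + 1 : ℝ) / N) with ha
  set v : Fin (N - 1) → NNReal := fun x =>
    Real.toNNReal (1 / β (((x : ℕ) + 1 : ℝ) / N)) with hv
  have hmp : MeasurePreserving Prod.fst (gibbsMeasure N m β rr pp mbar)
      (Measure.pi fun i => gaussianReal (a i) (v i)) := measurePreserving_fst
  have hmean : ∀ y, ∫ z', z'.1 y ∂(gibbsMeasure N m β rr pp mbar) = a y := by
    intro y
    have h := ((measurePreserving_eval (μ := fun i => gaussianReal (a i) (v i)) y).comp hmp)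
    have h2 := integral_map (μ := gibbsMeasure N m β rr pp mbar) h.measurable.aemeasurable (f := fun x : ℝ => x)
      aestronglyMeasurable_id
    rw [h.map_eq, integral_id_gaussianReal] at h2
    exact h2.symm
  have hfun : rCoord N (gibbsMeasure N m β rr pp mbar) u
      = (fun x : Fin (N - 1) → ℝ =>
          ∑ i : Fin (N - 1), (u ((i : ℕ) + 2) - u ((i : ℕ) + 1)) * (x i - a i)) ∘ Prod.fst := by
    ext z
    simp only [rCoord, hmean, Function.comp]
  obtain ⟨h1, h2⟩ := aux_gauss a v (fun i => u ((i : ℕ) + 2) - u ((i : ℕ) + 1))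
  rw [hfun]
  refine ⟨h1.comp_measurePreserving hmp, ?_⟩
  have h3 := integral_map (μ := gibbsMeasure N m β rr pp mbar) hmp.measurable.aemeasurable
    (f := fun x : Fin (N - 1) → ℝ =>
      (∑ i : Fin (N - 1), (u ((i : ℕ) + 2) - u ((i : ℕ) + 1)) * (x i - a i)) ^ 2)
    (by rw [hmp.map_eq]; exact h1.integrable_sq.1)
  rw [hmp.map_eq, h2] at h3
  refine (le_of_eq h3.symm).trans ?_
  have hsub : (∑ x ∈ Finset.Icc 1 (N - 1), (u (x + 1) - u x) * (u (x + 1) - u x)) / b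
      ≤ (∑ x ∈ Finset.Icc 1 N, (u (x + 1) - u x) * (u (x + 1) - u x)) / b := by
    refine div_le_div_of_nonneg_right ?_ hb.le
    exact Finset.sum_le_sum_of_subset_of_nonneg
      (Finset.Icc_subset_Icc le_rfl (Nat.sub_le _ _)) fun x _ _ => mul_self_nonneg _
  refine le_trans ?_ hsub
  rw [← aux_fin (N - 1) (fun x => (u (x + 1) - u x) * (u (x + 1) - u x)), Finset.sum_div]
  refine Finset.sum_le_sum fun y _ => ?_
  have hβy := hβ _ (aux_unit (Nat.sub_le N 1) y)
  have hv' : (v y : ℝ) ≤ 1 / b := by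
    rw [hv, Real.coe_toNNReal _ (div_nonneg zero_le_one (hb.le.trans hβy))]
    exact div_le_div_of_nonneg_left zero_le_one hb hβy
  calc (u ((y : ℕ) + 2) - u ((y : ℕ) + 1)) ^ 2 * (v y : ℝ)
      ≤ (u ((y : ℕ) + 2) - u ((y : ℕ) + 1)) ^ 2 * (1 / b) := by gcongr
    _ = _ := by ring

/-- second-moment bound for a combination of two square integrable variables -/
lemma aux_comb {Ω : Type*} [MeasurableSpace Ω] (ρ : Measure Ω) (P R : Ω → ℝ) (w b c s : ℝ)
    (hP : MemLp P 2 ρ) (hR : MemLp R 2 ρ) (hb : 0 < b) (hc : c ^ 2 ≤ 1) (hs : s ^ 2 ≤ 1)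
    (hPi : ∫ z, P z ^ 2 ∂ρ ≤ 1 / b) (hRi : ∫ z, R z ^ 2 ∂ρ ≤ w ^ 2 / b) :
    MemLp (fun z => P z * c + w⁻¹ * R z * s) 2 ρ ∧
    ∫ z, (P z * c + w⁻¹ * R z * s) ^ 2 ∂ρ ≤ 4 / b := by
  have hm : MemLp (fun z => P z * c + w⁻¹ * R z * s) 2 ρ :=
    (hP.mul_const c).add ((hR.const_mul w⁻¹).mul_const s)
  refine ⟨hm, ?_⟩
  have h0 : 0 ≤ ∫ z, P z ^ 2 ∂ρ := integral_nonneg fun z => sq_nonneg _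
  have h0' : 0 ≤ ∫ z, R z ^ 2 ∂ρ := integral_nonneg fun z => sq_nonneg _
  have hw : (w⁻¹) ^ 2 * (w ^ 2 / b) ≤ 1 / b := by
    by_cases h : w = 0
    · subst h; simp; positivity
    · apply le_of_eq; field_simp
  calc ∫ z, (P z * c + w⁻¹ * R z * s) ^ 2 ∂ρ
      ≤ ∫ z, (2 * P z ^ 2 + 2 * (w⁻¹) ^ 2 * R z ^ 2) ∂ρ := by
        refine integral_mono hm.integrable_sq
          ((hP.integrable_sq.const_mul _).add (hR.integrable_sq.const_mul _)) fun z => ?_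
        have e1 := mul_le_mul_of_nonneg_left hc (sq_nonneg (P z))
        have e2 := mul_le_mul_of_nonneg_left hs (sq_nonneg (w⁻¹ * R z))
        simp only
        nlinarith [sq_nonneg (P z * c - w⁻¹ * R z * s)]
    _ = 2 * ∫ z, P z ^ 2 ∂ρ + 2 * (w⁻¹) ^ 2 * ∫ z, R z ^ 2 ∂ρ := by
        rw [integral_add (hP.integrable_sq.const_mul _) (hR.integrable_sq.const_mul _),
          integral_const_mul, integral_const_mul]
    _ ≤ 2 * (1 / b) + 2 * ((w⁻¹) ^ 2 * (w ^ 2 / b)) := by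
        rw [mul_assoc 2 ((w⁻¹) ^ 2)]; gcongr
    _ ≤ 2 * (1 / b) + 2 * (1 / b) := by gcongr
    _ = 4 / b := by ring

open scoped Classical in
/-- the low modes (`k ≤ N^{1−α}`) carry a vanishing amount of thermal energy:
`|ℱ^{(1)}_N(t)| ≤ C N^{−α}` with `C` depending only on `sup|f|` and `β₋`. -/
theorem stmt9 (α : ℝ) (hα0 : 0 < α) (hα1 : α < 1)
    (f : ℝ → ℝ) (F : ℝ) (hfF : ∀ y ∈ Set.Icc (0:ℝ) 1, |f y| ≤ F)
    (βminus : ℝ) (hβminus : 0 < βminus) :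
    ∃ C : ℝ, ∀ N : ℕ, 2 ≤ N →
      ∀ mminus mplus : ℝ, 0 < mminus →
      ∀ m : ℕ → ℝ, (∀ x : ℕ, m x ∈ Set.Icc mminus mplus) →
      ∀ β rr pp : ℝ → ℝ,
        (∀ y ∈ Set.Icc (0:ℝ) 1, βminus ≤ β y) →
        ContinuousOn β (Set.Icc 0 1) →
        ContDiffOn ℝ 1 rr (Set.Icc 0 1) → rr 0 = 0 → rr 1 = 0 →
        ContDiffOn ℝ 1 pp (Set.Icc 0 1) →
      ∀ mbar : ℝ, 0 < mbar →
      ∀ ψ : ℕ → ℕ → ℝ, ∀ W : ℕ → ℝ, IsEigenSystem N m ψ W →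
      ∀ t : ℝ,
        (let ρ := gibbsMeasure N m β rr pp mbar
        |(1 / (N : ℝ)) * ∑ x ∈ Finset.Icc 1 N, f ((x : ℝ) / N) *
          ((∫ z, (∑ k ∈ (Finset.range N).filter
                (fun k : ℕ => (k : ℝ) ≤ (N : ℝ) ^ ((1 : ℝ) - α)),
              (pCoord N ρ (ψ k) z * Real.cos (W k * t)
                - (W k)⁻¹ * rCoord N ρ (ψ k) z * Real.sin (W k * t))
              * (m x * ψ k x)) ^ 2 ∂ρ) / (2 * m x)
          + (∫ z, (∑ k ∈ (Finset.range N).filter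
                (fun k : ℕ => 1 ≤ k ∧ (k : ℝ) ≤ (N : ℝ) ^ ((1 : ℝ) - α)),
              ((W k)⁻¹ * rCoord N ρ (ψ k) z * Real.cos (W k * t)
                + pCoord N ρ (ψ k) z * Real.sin (W k * t))
              * ((W k)⁻¹ * (ψ k (x + 1) - ψ k x))) ^ 2 ∂ρ) / 2)|
          ≤ C * (N : ℝ) ^ (-α)) := by
  have hF : 0 ≤ F := (abs_nonneg _).trans (hfF 0 (by simp))
  refine ⟨F * (8 / βminus), ?_⟩
  intro N hN mminus mplus hmm m hm β rr pp hβ _ _ _ _ _ mbar _ ψ W hE t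
  intro ρ
  have hmpos : ∀ x, 0 < m x := fun x => hmm.trans_le (hm x).1
  have hN0 : (0 : ℝ) < N := by exact_mod_cast (show 0 < N by omega)
  have hN1 : (1 : ℝ) ≤ N := by exact_mod_cast (show 1 ≤ N by omega)
  set S := (Finset.range N).filter (fun k : ℕ => (k : ℝ) ≤ (N : ℝ) ^ ((1 : ℝ) - α)) with hS
  set S' := (Finset.range N).filter
    (fun k : ℕ => 1 ≤ k ∧ (k : ℝ) ≤ (N : ℝ) ^ ((1 : ℝ) - α)) with hS'
  have hSN : ∀ k ∈ S, k ≤ N - 1 := fun k hk => by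
    have := Finset.mem_range.1 (Finset.mem_filter.1 hk).1
    omega
  have hSN' : ∀ k ∈ S', k ≤ N - 1 ∧ 1 ≤ k := fun k hk => by
    have := Finset.mem_range.1 (Finset.mem_filter.1 hk).1
    exact ⟨by omega, (Finset.mem_filter.1 hk).2.1⟩
  have hss : S' ⊆ S := fun k hk => by
    have := Finset.mem_filter.1 hk
    exact Finset.mem_filter.2 ⟨this.1, this.2.2⟩
  have hpow1 : (1 : ℝ) ≤ (N : ℝ) ^ ((1 : ℝ) - α) := Real.one_le_rpow hN1 (by linarith)
  have hcard : (S.card : ℝ) ≤ 2 * (N : ℝ) ^ ((1 : ℝ) - α) := by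
    have hsub : S ⊆ Finset.range (⌊(N : ℝ) ^ ((1 : ℝ) - α)⌋₊ + 1) := fun k hk => by
      have := (Finset.mem_filter.1 hk).2
      exact Finset.mem_range.2 (Nat.lt_succ_of_le (Nat.le_floor this))
    have h1 := Finset.card_le_card hsub
    rw [Finset.card_range] at h1
    have h2 : (S.card : ℝ) ≤ (⌊(N : ℝ) ^ ((1 : ℝ) - α)⌋₊ : ℝ) + 1 := by exact_mod_cast h1
    have h3 := Nat.floor_le (show 0 ≤ (N : ℝ) ^ ((1 : ℝ) - α) by linarith)
    linarith
  have hcard' : (S'.card : ℝ) ≤ S.card := by exact_mod_cast Finset.card_le_card hss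
  -- second moments of the mode coordinates
  have hPk : ∀ k ≤ N - 1, MemLp (pCoord N ρ (ψ k)) 2 ρ ∧
      ∫ z, pCoord N ρ (ψ k) z ^ 2 ∂ρ ≤ 1 / βminus := fun k hk => by
    have h := aux_p N m hmpos β rr pp mbar βminus hβminus hβ (ψ k)
    rw [hE.2.2.1 k hk k hk, if_pos rfl] at h
    exact h
  have hRk : ∀ k ≤ N - 1, MemLp (rCoord N ρ (ψ k)) 2 ρ ∧
      ∫ z, rCoord N ρ (ψ k) z ^ 2 ∂ρ ≤ W k ^ 2 / βminus := fun k hk => by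
    have h := aux_r N m β rr pp mbar βminus hβminus hβ (ψ k)
    rw [aux_grad hE k k hk hk, if_pos rfl] at h
    exact h
  have hA : ∀ k ≤ N - 1,
      MemLp (fun z => pCoord N ρ (ψ k) z * Real.cos (W k * t)
          - (W k)⁻¹ * rCoord N ρ (ψ k) z * Real.sin (W k * t)) 2 ρ ∧
      ∫ z, (pCoord N ρ (ψ k) z * Real.cos (W k * t)
          - (W k)⁻¹ * rCoord N ρ (ψ k) z * Real.sin (W k * t)) ^ 2 ∂ρ ≤ 4 / βminus := by
    intro k hk
    have h := aux_comb ρ _ _ (W k) βminus (Real.cos (W k * t)) (-Real.sin (W k * t))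
      (hPk k hk).1 (hRk k hk).1 hβminus (Real.cos_sq_le_one _)
      (by rw [neg_sq]; exact Real.sin_sq_le_one _) (hPk k hk).2 (hRk k hk).2
    simpa only [mul_neg, ← sub_eq_add_neg] using h
  have hB : ∀ k ≤ N - 1,
      MemLp (fun z => (W k)⁻¹ * rCoord N ρ (ψ k) z * Real.cos (W k * t)
          + pCoord N ρ (ψ k) z * Real.sin (W k * t)) 2 ρ ∧
      ∫ z, ((W k)⁻¹ * rCoord N ρ (ψ k) z * Real.cos (W k * t)
          + pCoord N ρ (ψ k) z * Real.sin (W k * t)) ^ 2 ∂ρ ≤ 4 / βminus := by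
    intro k hk
    have h := aux_comb ρ _ _ (W k) βminus (Real.sin (W k * t)) (Real.cos (W k * t))
      (hPk k hk).1 (hRk k hk).1 hβminus (Real.sin_sq_le_one _) (Real.cos_sq_le_one _)
      (hPk k hk).2 (hRk k hk).2
    simpa only [add_comm] using h
  have hpar := aux_parseval ρ S (Finset.Icc 1 N)
    (fun k z => pCoord N ρ (ψ k) z * Real.cos (W k * t)
          - (W k)⁻¹ * rCoord N ρ (ψ k) z * Real.sin (W k * t))
    (fun k hk => (hA k (hSN k hk)).1) (fun k x => m x * ψ k x) (fun x => (m x)⁻¹)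
    (fun j hj k hk => by
      rw [← hE.2.2.1 j (hSN j hj) k (hSN k hk)]
      refine Finset.sum_congr rfl fun x _ => ?_
      have := (hmpos x).ne'
      field_simp)
  have hpar' := aux_parseval ρ S' (Finset.Icc 1 N)
    (fun k z => (W k)⁻¹ * rCoord N ρ (ψ k) z * Real.cos (W k * t)
          + pCoord N ρ (ψ k) z * Real.sin (W k * t))
    (fun k hk => (hB k (hSN' k hk).1).1) (fun k x => (W k)⁻¹ * (ψ k (x + 1) - ψ k x))
    (fun _ => 1)
    (fun j hj k hk => by
      have h := aux_grad hE j k (hSN' j hj).1 (hSN' k hk).1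
      have h2 : ∑ x ∈ Finset.Icc 1 N, 1 * ((W j)⁻¹ * (ψ j (x + 1) - ψ j x)
            * ((W k)⁻¹ * (ψ k (x + 1) - ψ k x)))
          = (W j)⁻¹ * (W k)⁻¹ * ∑ x ∈ Finset.Icc 1 N,
            (ψ j (x + 1) - ψ j x) * (ψ k (x + 1) - ψ k x) := by
        rw [Finset.mul_sum]
        exact Finset.sum_congr rfl fun x _ => by ring
      rw [h2, h]
      split_ifs with hjk
      · subst hjk
        have := (hE.2.2.2.2 j (hSN' j hj).2 (hSN' j hj).1).ne'
        field_simp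
      · simp)
  have hle1 := Finset.sum_le_card_nsmul S _ _ fun k hk => (hA k (hSN k hk)).2
  have hle2 := Finset.sum_le_card_nsmul S' _ _ fun k hk => (hB k (hSN' k hk).1).2
  rw [nsmul_eq_mul] at hle1 hle2
  rw [← hpar] at hle1
  rw [← hpar'] at hle2
  simp only [one_mul] at hle2
  -- abstract the two energies
  set I : ℕ → ℝ := fun x => ∫ z, (∑ k ∈ S, (pCoord N ρ (ψ k) z * Real.cos (W k * t)
      - (W k)⁻¹ * rCoord N ρ (ψ k) z * Real.sin (W k * t)) * (m x * ψ k x)) ^ 2 ∂ρ with hI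
  set J : ℕ → ℝ := fun x => ∫ z, (∑ k ∈ S', ((W k)⁻¹ * rCoord N ρ (ψ k) z * Real.cos (W k * t)
      + pCoord N ρ (ψ k) z * Real.sin (W k * t)) * ((W k)⁻¹ * (ψ k (x + 1) - ψ k x))) ^ 2 ∂ρ
    with hJ
  have hI0 : ∀ x, 0 ≤ I x := fun x => integral_nonneg fun z => sq_nonneg _
  have hJ0 : ∀ x, 0 ≤ J x := fun x => integral_nonneg fun z => sq_nonneg _
  change ∑ x ∈ Finset.Icc 1 N, (m x)⁻¹ * I x ≤ _ at hle1
  change ∑ x ∈ Finset.Icc 1 N, J x ≤ _ at hle2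
  change |(1 / (N : ℝ)) * ∑ x ∈ Finset.Icc 1 N, f ((x : ℝ) / N)
    * (I x / (2 * m x) + J x / 2)| ≤ _
  have hb4 : 0 ≤ 4 / βminus := by positivity
  have hsum : |∑ x ∈ Finset.Icc 1 N, f ((x : ℝ) / N) * (I x / (2 * m x) + J x / 2)|
      ≤ F * (8 / βminus * (N : ℝ) ^ ((1 : ℝ) - α)) := by
    calc |∑ x ∈ Finset.Icc 1 N, f ((x : ℝ) / N) * (I x / (2 * m x) + J x / 2)|
        ≤ ∑ x ∈ Finset.Icc 1 N, |f ((x : ℝ) / N) * (I x / (2 * m x) + J x / 2)| :=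
          Finset.abs_sum_le_sum_abs _ _
      _ ≤ ∑ x ∈ Finset.Icc 1 N, F * (1 / 2 * ((m x)⁻¹ * I x) + 1 / 2 * J x) := by
          refine Finset.sum_le_sum fun x hx => ?_
          rw [Finset.mem_Icc] at hx
          have hxN : (x : ℝ) ≤ N := by exact_mod_cast hx.2
          have hmx := hmpos x
          have hIx := hI0 x
          have hJx := hJ0 x
          have hnn : 0 ≤ I x / (2 * m x) + J x / 2 := by positivity
          have heq : 1 / 2 * ((m x)⁻¹ * I x) + 1 / 2 * J x = I x / (2 * m x) + J x / 2 := by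
            field_simp
          rw [abs_mul, abs_of_nonneg hnn, heq]
          exact mul_le_mul_of_nonneg_right
            (hfF _ ⟨by positivity, by rw [div_le_one hN0]; exact hxN⟩) hnn
      _ = F * (1 / 2 * ∑ x ∈ Finset.Icc 1 N, (m x)⁻¹ * I x
            + 1 / 2 * ∑ x ∈ Finset.Icc 1 N, J x) := by
          rw [← Finset.mul_sum, Finset.sum_add_distrib, ← Finset.mul_sum, ← Finset.mul_sum]
      _ ≤ F * (8 / βminus * (N : ℝ) ^ ((1 : ℝ) - α)) := by
          refine mul_le_mul_of_nonneg_left ?_ hF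
          have e1 := mul_le_mul_of_nonneg_right hcard hb4
          have e2 := mul_le_mul_of_nonneg_right hcard' hb4
          have e3 : 8 / βminus * (N : ℝ) ^ ((1 : ℝ) - α)
            = 2 * (N : ℝ) ^ ((1 : ℝ) - α) * (4 / βminus) := by ring
          rw [e3]
          linarith
  rw [abs_mul, abs_of_pos (by positivity : (0 : ℝ) < 1 / N)]
  calc 1 / (N : ℝ) * |∑ x ∈ Finset.Icc 1 N, f ((x : ℝ) / N) * (I x / (2 * m x) + J x / 2)|
      ≤ 1 / (N : ℝ) * (F * (8 / βminus * (N : ℝ) ^ ((1 : ℝ) - α))) := by gcongr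
    _ = F * (8 / βminus) * (N : ℝ) ^ (-α) := by
        have : (N : ℝ) ^ ((1 : ℝ) - α) = N * (N : ℝ) ^ (-α) := by
          rw [sub_eq_add_neg, Real.rpow_add hN0, Real.rpow_one]
        rw [this]
        field_simp
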